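/- Let p be a prime, k a positive integer, and E = (Z_p)^k the elementary Abelian p-group of rank k. Then β(E) = kp − k + 1. -/

import Mathlib

/-!  Definition of the Noether number `β(G)` of a group `G`, over the field `ℂ`
(of characteristic 0).  A finite-dimensional `ℂG`-module is (up to isomorphism)
given by a representation `ρ : Representation ℂ G (Fin n → ℂ)`; the algebra of
polynomial invariants is realised inside `MvPolynomial (Fin n) ℂ` as the
common equalizer of the substitution maps induced by the group elements. -/

/-- The algebra endomorphism of the polynomial ring induced by the linear action of
`g : G` on the underlying space (substitution of the variables by linear forms). -/
noncomputable def Representation.polySubst {G : Type*} [Group G] {n : ℕ}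
    (ρ : Representation ℂ G (Fin n → ℂ)) (g : G) :
    MvPolynomial (Fin n) ℂ →ₐ[ℂ] MvPolynomial (Fin n) ℂ :=
  MvPolynomial.aeval fun i =>
    ∑ j, MvPolynomial.C (LinearMap.toMatrix' (ρ g) i j) * MvPolynomial.X j

/-- The subalgebra of `G`-invariant polynomials. -/
noncomputable def Representation.invariantAlgebra {G : Type*} [Group G] {n : ℕ}
    (ρ : Representation ℂ G (Fin n → ℂ)) : Subalgebra ℂ (MvPolynomial (Fin n) ℂ) :=
  ⨅ g : G, AlgHom.equalizer (ρ.polySubst g) (AlgHom.id ℂ (MvPolynomial (Fin n) ℂ))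

/-- The invariant algebra is generated by its elements of (total) degree at most `d`. -/
def Representation.InvariantsGeneratedInDegree {G : Type*} [Group G] {n : ℕ}
    (ρ : Representation ℂ G (Fin n → ℂ)) (d : ℕ) : Prop :=
  Algebra.adjoin ℂ {f : MvPolynomial (Fin n) ℂ | f ∈ ρ.invariantAlgebra ∧ f.totalDegree ≤ d}
    = ρ.invariantAlgebra

/-- The Noether number `β(G)`: the smallest degree bound `d` such that for every
finite-dimensional `ℂG`-module the algebra of polynomial invariants is generated
by its elements of degree at most `d`.  (Equivalently, the maximum over all
finite-dimensional modules `V` of the minimal generating degree `β(G,V)`.) -/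
noncomputable def noetherNumber (G : Type*) [Group G] : ℕ :=
  sInf {d : ℕ | ∀ (n : ℕ) (ρ : Representation ℂ G (Fin n → ℂ)),
    ρ.InvariantsGeneratedInDegree d}

/-- The Noether index `n(G) = |G| / β(G)`, as a real number. -/
noncomputable def noetherIndex (G : Type*) [Group G] : ℝ :=
  (Nat.card G : ℝ) / (noetherNumber G : ℝ)

/-- Olson's theorem: a family of more than `k * (p - 1)` vectors of `(ZMod p)^k` has a nonempty
subfamily with sum zero. -/
theorem exists_subset_sum_eq_zero {p k : ℕ} [Fact p.Prime] {ι : Type*} (s : Finset ι)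
    (w : ι → Fin k → ZMod p) (hs : k * (p - 1) < s.card) :
    ∃ t ⊆ s, t.Nonempty ∧ ∑ i ∈ t, w i = 0 := by
  classical
  have hp : p.Prime := Fact.out
  have hp1 : p - 1 ≠ 0 := by have := hp.two_le; omega
  let f : Fin k → MvPolynomial s (ZMod p) := fun j =>
    ∑ i : s, w i j • MvPolynomial.X i ^ (p - 1)
  have hdeg : ∑ j, (f j).totalDegree < Fintype.card s := by
    calc ∑ j, (f j).totalDegree ≤ ∑ _j : Fin k, (p - 1) := by
          refine Finset.sum_le_sum fun j _ => MvPolynomial.totalDegree_finsetSum_le fun i _ => ?_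
          exact (MvPolynomial.totalDegree_smul_le ..).trans (MvPolynomial.totalDegree_X_pow ..).le
      _ < Fintype.card s := by simpa using hs
  have hdvd := char_dvd_card_solutions_of_fintype_sum_lt p hdeg
  rw [← @Nat.card_eq_fintype_card _ (_)] at hdvd
  let z : {x : s → ZMod p // ∀ j, MvPolynomial.eval x (f j) = 0} := ⟨0, fun j => by simp [f, hp1]⟩
  have hcard := hp.one_lt.trans_le (Nat.le_of_dvd (Nat.card_pos_iff.2 ⟨⟨z⟩, inferInstance⟩) hdvd)
  have := Finite.one_lt_card_iff_nontrivial.1 hcard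
  obtain ⟨⟨x, hx⟩, hne⟩ := exists_ne z
  have hx0 : x ≠ 0 := fun h => hne (Subtype.ext h)
  obtain ⟨a, ha⟩ := Function.ne_iff.1 hx0
  refine ⟨(Finset.univ.filter fun i => x i ≠ 0).map (Function.Embedding.subtype _), ?_, ?_, ?_⟩
  · intro i hi
    obtain ⟨b, -, rfl⟩ := Finset.mem_map.1 hi
    exact b.2
  · exact ⟨a, Finset.mem_map.2 ⟨a, by simpa using ha, rfl⟩⟩
  · ext j
    have hj := hx j
    simp only [f, map_sum, MvPolynomial.smul_eval, map_pow, MvPolynomial.eval_X] at hj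
    rw [Finset.sum_map, Finset.sum_apply, Finset.sum_filter, Pi.zero_apply]
    refine Eq.trans ?_ hj
    refine Finset.sum_congr rfl fun i _ => ?_
    by_cases hi : x i = 0
    · simp [hi, hp1]
    · simp [hi, ZMod.pow_card_sub_one_eq_one hi]

/-- A zero-sum product of weighted elements lies in every subalgebra containing all zero-sum
products of at most `k * (p - 1) + 1` of them. -/
theorem prod_mem_of_sum_eq_zero {p k : ℕ} [Fact p.Prime] {ι R A : Type*} [CommSemiring R]
    [CommSemiring A] [Algebra R A] (B : Subalgebra R A) (l : ι → A) (w : ι → Fin k → ZMod p)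
    (hB : ∀ t : Finset ι, t.card ≤ k * (p - 1) + 1 → ∑ i ∈ t, w i = 0 → ∏ i ∈ t, l i ∈ B)
    (s : Finset ι) (hs : ∑ i ∈ s, w i = 0) : ∏ i ∈ s, l i ∈ B := by
  classical
  induction s using Finset.strongInduction with
  | H s ih =>
    by_cases hc : s.card ≤ k * (p - 1) + 1
    · exact hB s hc hs
    · obtain ⟨u, hus, hu⟩ := Finset.exists_subset_card_eq (s := s) (n := k * (p - 1) + 1) (by omega)
      obtain ⟨t, htu, htne, ht⟩ := exists_subset_sum_eq_zero u w (by omega)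
      have hts := htu.trans hus
      rw [← Finset.prod_sdiff hts]
      refine mul_mem (ih _ (Finset.sdiff_ssubset hts htne) ?_)
        (hB t (hu ▸ Finset.card_le_card htu) ht)
      have h := Finset.sum_sdiff (f := w) hts
      rwa [ht, hs, add_zero] at h

/-- The additive character of `(ZMod p)^k` attached to a vector `v`. -/
noncomputable def vectorAddChar {p k : ℕ} [NeZero p] (v : Fin k → ZMod p) :
    AddChar (Fin k → ZMod p) ℂ where
  toFun x := ZMod.stdAddChar (v ⬝ᵥ x)
  map_zero_eq_one' := by simp
  map_add_eq_mul' x y := by simp [dotProduct_add, AddChar.map_add_eq_mul]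

section vectorAddChar

variable {p k : ℕ} [NeZero p]

theorem vectorAddChar_apply (v x : Fin k → ZMod p) :
    vectorAddChar v x = ZMod.stdAddChar (v ⬝ᵥ x) := rfl

theorem vectorAddChar_comm (v x : Fin k → ZMod p) : vectorAddChar v x = vectorAddChar x v := by
  rw [vectorAddChar_apply, vectorAddChar_apply, dotProduct_comm]

theorem vectorAddChar_zero : vectorAddChar (0 : Fin k → ZMod p) = 0 := by
  ext x
  simp [vectorAddChar_apply]

theorem vectorAddChar_add (v w x : Fin k → ZMod p) :
    vectorAddChar (v + w) x = vectorAddChar v x * vectorAddChar w x := by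
  rw [vectorAddChar_comm, AddChar.map_add_eq_mul, vectorAddChar_comm, vectorAddChar_comm x]

theorem vectorAddChar_sum {ι : Type*} (s : Finset ι) (w : ι → Fin k → ZMod p)
    (x : Fin k → ZMod p) :
    vectorAddChar (∑ i ∈ s, w i) x = ∏ i ∈ s, vectorAddChar (w i) x := by
  classical
  induction s using Finset.induction_on with
  | empty => simp [vectorAddChar_zero]
  | insert a s ha ih => rw [Finset.sum_insert ha, Finset.prod_insert ha, vectorAddChar_add, ih]

theorem vectorAddChar_eq_zero_iff (v : Fin k → ZMod p) : vectorAddChar v = 0 ↔ v = 0 := by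
  refine ⟨fun h => ?_, fun h => h ▸ vectorAddChar_zero⟩
  ext i
  have hi : vectorAddChar v (Pi.single i 1) = 1 := by rw [h]; rfl
  rw [vectorAddChar_apply, dotProduct_single_one, ← AddChar.map_zero_eq_one
    (ZMod.stdAddChar (N := p))] at hi
  exact ZMod.injective_stdAddChar hi

theorem sum_vectorAddChar (v : Fin k → ZMod p) :
    ∑ x, vectorAddChar v x = if v = 0 then (p : ℂ) ^ k else 0 := by
  classical
  rw [AddChar.sum_eq_ite]
  simp [vectorAddChar_eq_zero_iff]

end vectorAddChar

namespace Representation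

section General

variable {G : Type*} [Group G] {n : ℕ} (ρ : Representation ℂ G (Fin n → ℂ))

theorem mem_invariantAlgebra {f : MvPolynomial (Fin n) ℂ} :
    f ∈ ρ.invariantAlgebra ↔ ∀ g, ρ.polySubst g f = f := by
  simp [invariantAlgebra, Algebra.mem_iInf, AlgHom.mem_equalizer]

theorem polySubst_X (g : G) (i : Fin n) :
    ρ.polySubst g (MvPolynomial.X i) =
      ∑ j, MvPolynomial.C (LinearMap.toMatrix' (ρ g) i j) * MvPolynomial.X j := by
  simp [polySubst]

theorem polySubst_one (f : MvPolynomial (Fin n) ℂ) : ρ.polySubst 1 f = f := by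
  suffices h : ρ.polySubst 1 = AlgHom.id ℂ _ by rw [h]; rfl
  ext1 i
  rw [polySubst_X, map_one, Module.End.one_eq_id, LinearMap.toMatrix'_id]
  simp [Matrix.one_apply]

theorem polySubst_polySubst (g h : G) (f : MvPolynomial (Fin n) ℂ) :
    ρ.polySubst g (ρ.polySubst h f) = ρ.polySubst (h * g) f := by
  suffices H : (ρ.polySubst g).comp (ρ.polySubst h) = ρ.polySubst (h * g) by rw [← H]; rfl
  ext1 i
  rw [AlgHom.comp_apply, polySubst_X, polySubst_X, map_mul, Module.End.mul_eq_comp,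
    LinearMap.toMatrix'_comp]
  simp only [map_sum, map_mul, polySubst_X, MvPolynomial.algHom_C, MvPolynomial.algebraMap_eq,
    Matrix.mul_apply, Finset.mul_sum, Finset.sum_mul]
  rw [Finset.sum_comm]
  simp [mul_assoc]

theorem totalDegree_polySubst_X_le (g : G) (i : Fin n) :
    (ρ.polySubst g (MvPolynomial.X i)).totalDegree ≤ 1 := by
  rw [polySubst_X]
  refine MvPolynomial.totalDegree_finsetSum_le fun j _ => ?_
  rw [← MvPolynomial.smul_eq_C_mul]
  exact (MvPolynomial.totalDegree_smul_le ..).trans (MvPolynomial.totalDegree_X j).le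

end General

section ElementaryAbelian

variable {p k n : ℕ}

/-- The polynomial `f` is a simultaneous eigenvector on which the group acts through the
character attached to `v`. -/
def IsWeightVector [NeZero p] (ρ : Representation ℂ (Multiplicative (Fin k → ZMod p)) (Fin n → ℂ))
    (v : Fin k → ZMod p) (f : MvPolynomial (Fin n) ℂ) : Prop :=
  ∀ x, ρ.polySubst (Multiplicative.ofAdd x) f = vectorAddChar v x • f

theorem IsWeightVector.prod [NeZero p]
    {ρ : Representation ℂ (Multiplicative (Fin k → ZMod p)) (Fin n → ℂ)} {ι : Type*} {s : Finset ι}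
    {l : ι → MvPolynomial (Fin n) ℂ} {w : ι → Fin k → ZMod p}
    (h : ∀ i ∈ s, ρ.IsWeightVector (w i) (l i)) :
    ρ.IsWeightVector (∑ i ∈ s, w i) (∏ i ∈ s, l i) := by
  intro x
  rw [map_prod, Finset.prod_congr rfl fun i hi => h i hi x, Finset.prod_smul, vectorAddChar_sum]

variable (ρ : Representation ℂ (Multiplicative (Fin k → ZMod p)) (Fin n → ℂ))

theorem isWeightVector_zero_iff [NeZero p] {f : MvPolynomial (Fin n) ℂ} :
    ρ.IsWeightVector 0 f ↔ f ∈ ρ.invariantAlgebra := by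
  simp [IsWeightVector, mem_invariantAlgebra, vectorAddChar_zero, Multiplicative.forall]

/-- The projection of the variable `X i` to the weight space of `v`, scaled by the group order. -/
noncomputable def weightForm [NeZero p] (v : Fin k → ZMod p) (i : Fin n) :
    MvPolynomial (Fin n) ℂ :=
  ∑ x, vectorAddChar (-v) x • ρ.polySubst (Multiplicative.ofAdd x) (MvPolynomial.X i)

theorem isWeightVector_weightForm [NeZero p] (v : Fin k → ZMod p) (i : Fin n) :
    ρ.IsWeightVector v (ρ.weightForm v i) := by
  intro y
  simp only [weightForm, map_sum, map_smul, polySubst_polySubst, Finset.smul_sum, smul_smul,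
    ← ofAdd_add]
  refine Fintype.sum_equiv (Equiv.addRight y) _ _ fun x => ?_
  rw [Equiv.coe_addRight, AddChar.map_add_eq_mul, mul_left_comm, ← vectorAddChar_add]
  simp [vectorAddChar_zero]

theorem totalDegree_weightForm_le [NeZero p] (v : Fin k → ZMod p) (i : Fin n) :
    (ρ.weightForm v i).totalDegree ≤ 1 :=
  MvPolynomial.totalDegree_finsetSum_le fun _ _ =>
    (MvPolynomial.totalDegree_smul_le ..).trans (ρ.totalDegree_polySubst_X_le _ i)

theorem sum_weightForm [NeZero p] (i : Fin n) :
    ∑ v, ρ.weightForm v i = ((p : ℂ) ^ k) • MvPolynomial.X i := by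
  have h (x : Fin k → ZMod p) : ∑ v, vectorAddChar (-v) x = if x = 0 then (p : ℂ) ^ k else 0 := by
    rw [← sum_vectorAddChar]
    exact Fintype.sum_equiv (Equiv.neg _) _ _ fun v => vectorAddChar_comm _ _
  simp only [weightForm]
  rw [Finset.sum_comm]
  simp only [← Finset.sum_smul, h, ite_smul, zero_smul]
  simp [polySubst_one]

theorem adjoin_weightForm [NeZero p] :
    Algebra.adjoin ℂ {f | ∃ v i, f = ρ.weightForm v i} = ⊤ := by
  rw [eq_top_iff, ← MvPolynomial.adjoin_range_X]
  refine Algebra.adjoin_le ?_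
  rintro _ ⟨i, rfl⟩
  have hp : (p : ℂ) ^ k ≠ 0 := pow_ne_zero _ (Nat.cast_ne_zero.2 (NeZero.ne p))
  rw [SetLike.mem_coe, ← inv_smul_smul₀ hp (MvPolynomial.X i), ← ρ.sum_weightForm i]
  refine Subalgebra.smul_mem _ (Subalgebra.sum_mem _ fun v _ => ?_) _
  exact Algebra.subset_adjoin ⟨v, i, rfl⟩

/-- The sum of the translates of a polynomial under the group. -/
noncomputable def orbitSum [NeZero p] : MvPolynomial (Fin n) ℂ →ₗ[ℂ] MvPolynomial (Fin n) ℂ :=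
  ∑ x : Fin k → ZMod p, (ρ.polySubst (Multiplicative.ofAdd x)).toLinearMap

theorem orbitSum_of_isWeightVector [NeZero p] {v : Fin k → ZMod p} {f : MvPolynomial (Fin n) ℂ}
    (h : ρ.IsWeightVector v f) :
    ρ.orbitSum f = (if v = 0 then (p : ℂ) ^ k else 0) • f := by
  rw [← sum_vectorAddChar, Finset.sum_smul, orbitSum, LinearMap.sum_apply]
  exact Finset.sum_congr rfl fun x _ => h x

theorem invariantsGeneratedInDegree [Fact p.Prime] :
    ρ.InvariantsGeneratedInDegree (k * (p - 1) + 1) := by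
  refine le_antisymm (Algebra.adjoin_le fun f hf => hf.1) fun f hf => ?_
  set B := Algebra.adjoin ℂ {f : MvPolynomial (Fin n) ℂ |
    f ∈ ρ.invariantAlgebra ∧ f.totalDegree ≤ k * (p - 1) + 1}
  have key : ∀ f, ρ.orbitSum f ∈ B := by
    intro f
    have hf : f ∈ Submodule.span ℂ (Submonoid.closure {f | ∃ v i, f = ρ.weightForm v i} :
        Set (MvPolynomial (Fin n) ℂ)) := by
      rw [← Algebra.adjoin_eq_span, adjoin_weightForm]
      trivial
    induction hf using Submodule.span_induction with
    | zero => rw [map_zero]; exact zero_mem _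
    | add x y _ _ hx hy => rw [map_add]; exact add_mem hx hy
    | smul a x _ hx => rw [map_smul]; exact Subalgebra.smul_mem _ hx _
    | mem x hx =>
      obtain ⟨L, hL, rfl⟩ := Submonoid.exists_list_of_mem_closure hx
      choose v i hvi using fun j : Fin L.length => hL _ (L.getElem_mem j.2)
      have hw (t : Finset (Fin L.length)) : ρ.IsWeightVector (∑ j ∈ t, v j) (∏ j ∈ t, L[j]) :=
        IsWeightVector.prod fun j _ => by
          rw [Fin.getElem_fin, hvi j]
          exact ρ.isWeightVector_weightForm _ _
      have hprod : L.prod = ∏ j : Fin L.length, L[j] := (Fin.prod_univ_getElem L).symm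
      rw [hprod, ρ.orbitSum_of_isWeightVector (hw _)]
      split_ifs with h0
      · refine Subalgebra.smul_mem _ (prod_mem_of_sum_eq_zero B (fun j : Fin L.length => L[j]) v
          (fun t htc ht => Algebra.subset_adjoin ⟨?_, ?_⟩) _ h0) _
        · rw [← ρ.isWeightVector_zero_iff, ← ht]
          exact hw t
        · refine (MvPolynomial.totalDegree_finsetProd _ _).trans (le_trans ?_ htc)
          rw [Finset.card_eq_sum_ones]
          refine Finset.sum_le_sum fun j _ => ?_
          rw [Fin.getElem_fin, hvi j]
          exact ρ.totalDegree_weightForm_le _ _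
      · rw [zero_smul]; exact zero_mem _
  have hp : (p : ℂ) ^ k ≠ 0 := pow_ne_zero _ (Nat.cast_ne_zero.2 (NeZero.ne p))
  have h := key f
  rw [ρ.orbitSum_of_isWeightVector (ρ.isWeightVector_zero_iff.2 hf), if_pos rfl] at h
  simpa [smul_smul, hp] using Subalgebra.smul_mem _ h ((p : ℂ) ^ k)⁻¹

/-- The diagonal representation with the given weights. -/
noncomputable def diagonalRep [NeZero p] (w : Fin n → Fin k → ZMod p) :
    Representation ℂ (Multiplicative (Fin k → ZMod p)) (Fin n → ℂ) where
  toFun g := Matrix.toLin' (Matrix.diagonal fun i => vectorAddChar (w i) g.toAdd)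
  map_one' := by simp [Module.End.one_eq_id]
  map_mul' g h := by
    rw [Module.End.mul_eq_comp, ← Matrix.toLin'_mul, Matrix.diagonal_mul_diagonal]
    simp [AddChar.map_add_eq_mul]

theorem isWeightVector_diagonalRep_monomial [NeZero p] (w : Fin n → Fin k → ZMod p)
    (m : Fin n →₀ ℕ) (c : ℂ) :
    (diagonalRep w).IsWeightVector (∑ i, m i • w i) (MvPolynomial.monomial m c) := by
  intro x
  have hX (i : Fin n) : (diagonalRep w).polySubst (Multiplicative.ofAdd x) (MvPolynomial.X i) =
      MvPolynomial.C (vectorAddChar (w i) x) * MvPolynomial.X i := by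
    have h : LinearMap.toMatrix' (diagonalRep w (Multiplicative.ofAdd x)) =
        Matrix.diagonal fun i => vectorAddChar (w i) x := LinearMap.toMatrix'_toLin' _
    rw [polySubst_X, h]
    simp [Matrix.diagonal_apply, apply_ite MvPolynomial.C]
  rw [MvPolynomial.monomial_eq, map_mul, MvPolynomial.algHom_C, Finsupp.prod_fintype _ _ (by simp),
    map_prod, vectorAddChar_sum]
  simp only [map_pow, hX, mul_pow, Finset.prod_mul_distrib, MvPolynomial.algebraMap_eq,
    MvPolynomial.smul_eq_C_mul, map_prod]
  simp only [vectorAddChar_comm _ x, AddChar.map_nsmul_eq_pow, map_pow]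
  ring

theorem sum_smul_eq_zero_of_mem_support [NeZero p] {w : Fin n → Fin k → ZMod p}
    {f : MvPolynomial (Fin n) ℂ} (hf : f ∈ (diagonalRep w).invariantAlgebra) {m : Fin n →₀ ℕ}
    (hm : m ∈ f.support) : ∑ i, m i • w i = 0 := by
  classical
  rw [← vectorAddChar_eq_zero_iff]
  ext x
  have h := congrArg (MvPolynomial.coeff m)
    ((mem_invariantAlgebra _).1 hf (Multiplicative.ofAdd x))
  conv_lhs at h => rw [f.as_sum, map_sum]
  simp only [isWeightVector_diagonalRep_monomial w _ _ x, MvPolynomial.coeff_sum,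
    MvPolynomial.coeff_smul, MvPolynomial.coeff_monomial, smul_eq_mul, mul_ite, mul_zero] at h
  rw [Finset.sum_ite_eq' , if_pos hm] at h
  simpa using mul_right_cancel₀ (MvPolynomial.mem_support_iff.1 hm) (h.trans (one_mul _).symm)

/-- An invariant monomial all of whose invariant divisors are trivial bounds the degrees of
generators from below. -/
theorem degree_le_of_invariantsGeneratedInDegree [NeZero p] {w : Fin n → Fin k → ZMod p}
    {m : Fin n →₀ ℕ} (hm0 : m ≠ 0) (hm : ∑ i, m i • w i = 0)
    (hmin : ∀ a ≤ m, ∑ i, a i • w i = 0 → a = 0 ∨ a = m) {d : ℕ}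
    (hd : (diagonalRep w).InvariantsGeneratedInDegree d) : m.degree ≤ d := by
  classical
  by_contra! hlt
  let T : Subalgebra ℂ (MvPolynomial (Fin n) ℂ) :=
    { carrier := {f | f ∈ (diagonalRep w).invariantAlgebra ∧ f.coeff m = 0}
      add_mem' := fun {f g} hf hg => ⟨add_mem hf.1 hg.1, by simp [hf.2, hg.2]⟩
      algebraMap_mem' := fun r => ⟨Subalgebra.algebraMap_mem _ r, by
        simp [MvPolynomial.algebraMap_eq, MvPolynomial.coeff_C, hm0.symm]⟩
      mul_mem' := fun {f g} hf hg => ⟨mul_mem hf.1 hg.1, by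
        rw [MvPolynomial.coeff_mul]
        refine Finset.sum_eq_zero fun a ha => ?_
        rw [Finset.HasAntidiagonal.mem_antidiagonal] at ha
        by_cases hfa : f.coeff a.1 = 0
        · rw [hfa, zero_mul]
        · rcases hmin a.1 (ha ▸ le_self_add)
            (sum_smul_eq_zero_of_mem_support hf.1 (MvPolynomial.mem_support_iff.2 hfa)) with h | h
          · rw [h, zero_add] at ha
            rw [ha, hg.2, mul_zero]
          · exact absurd (h ▸ hf.2) hfa⟩ }
  have hle : Algebra.adjoin ℂ {f : MvPolynomial (Fin n) ℂ |
      f ∈ (diagonalRep w).invariantAlgebra ∧ f.totalDegree ≤ d} ≤ T := by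
    refine Algebra.adjoin_le fun f hf => ⟨hf.1, ?_⟩
    by_contra hne
    have h : m.degree ≤ f.totalDegree :=
      MvPolynomial.le_totalDegree (MvPolynomial.mem_support_iff.2 hne)
    exact absurd (h.trans hf.2) hlt.not_ge
  rw [hd] at hle
  have hmem : MvPolynomial.monomial m (1 : ℂ) ∈ (diagonalRep w).invariantAlgebra := by
    rw [← isWeightVector_zero_iff, ← hm]
    exact isWeightVector_diagonalRep_monomial w m 1
  simpa using (hle hmem).2

theorem le_of_forall_invariantsGeneratedInDegree [Fact p.Prime] {d : ℕ}
    (hd : ∀ (n : ℕ) (ρ : Representation ℂ (Multiplicative (Fin k → ZMod p)) (Fin n → ℂ)),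
      ρ.InvariantsGeneratedInDegree d) : k * (p - 1) + 1 ≤ d := by
  have hp : p.Prime := Fact.out
  let w : Fin (k + 1) → Fin k → ZMod p := Fin.cons 1 fun i => Pi.single i 1
  let m : Fin (k + 1) →₀ ℕ := Finsupp.equivFunOnFinite.symm (Fin.cons 1 fun _ => p - 1)
  have hw (a : Fin (k + 1) →₀ ℕ) (h : ∑ i, a i • w i = 0) (j : Fin k) : p ∣ a 0 + a j.succ := by
    have hj := congrFun h j
    rw [Fin.sum_univ_succ] at hj
    simp [w, Pi.single_apply] at hj
    rw [← ZMod.natCast_eq_zero_iff]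
    exact_mod_cast hj
  have hdeg : m.degree = k * (p - 1) + 1 := by
    simp [Finsupp.degree_eq_sum, m, Fin.sum_univ_succ, add_comm]
  rw [← hdeg]
  refine degree_le_of_invariantsGeneratedInDegree (w := w) ?_ ?_ ?_ (hd _ _)
  · intro h
    simpa [m] using DFunLike.congr_fun h 0
  · ext j
    rw [Fin.sum_univ_succ]
    simp [w, m, Pi.single_apply, Nat.cast_sub hp.one_le]
  · intro a ha h
    have h0 : a 0 ≤ 1 := ha 0
    have hs (j : Fin k) : a j.succ ≤ p - 1 := ha j.succ
    have hp2 := hp.two_le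
    rcases Nat.le_one_iff_eq_zero_or_eq_one.1 h0 with h1 | h1
    · left
      ext i
      refine Fin.cases h1 (fun j => ?_) i
      have := hw a h j
      rw [h1, zero_add] at this
      exact Nat.eq_zero_of_dvd_of_lt this (by have := hs j; omega)
    · right
      ext i
      refine Fin.cases h1 (fun j => ?_) i
      have h2 := Nat.le_of_dvd (by omega) (hw a h j)
      have h3 := hs j
      change a j.succ = p - 1
      omega

end ElementaryAbelian

end Representation

/-- **Lemma (Olson).**  For the elementary abelian `p`-group `E = (Z_p)^k` of rank
`k ≥ 1` we have `β(E) = kp - k + 1`. -/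
theorem noetherNumber_elementary_abelian
    (p k : ℕ) (hp : p.Prime) (hk : 0 < k) :
    noetherNumber (Multiplicative (Fin k → ZMod p)) = k * p - k + 1 := by
  have : Fact p.Prime := ⟨hp⟩
  have h : k * p - k = k * (p - 1) := by rw [Nat.mul_sub, mul_one]
  rw [h]
  exact IsLeast.csInf_eq ⟨fun _ ρ => ρ.invariantsGeneratedInDegree,
    fun _ hd => Representation.le_of_forall_invariantsGeneratedInDegree hd⟩
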